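/- Let X be a reflexive Banach space and let f₁, …, f_N : X → ℝ be U-functions such that f_i has the small diameter property for every i = 1, …, N. Then the set of Pareto Optimum points for f₁, …, f_N is a compact and connected subset of X. -/

import Mathlib

open Filter

/-- `f : X → ℝ` is a *U-function*: continuous, strictly convex, bounded on bounded
sets, and coercive (every sublevel set is bounded). -/
def IsUFunction {X : Type*} [NormedAddCommGroup X] [NormedSpace ℝ X]
    (f : X → ℝ) : Prop :=
  Continuous f ∧
  (∀ x y : X, x ≠ y → f ((1 / 2 : ℝ) • (x + y)) < (f x + f y) / 2) ∧
  (∀ s : Set X, Bornology.IsBounded s → Bornology.IsBounded (f '' s)) ∧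
  (∀ C : ℝ, Bornology.IsBounded {x : X | f x ≤ C})

/-- `xs` belongs to the subdifferential of `f : X → ℝ` at `x`. -/
def Subdiff {X : Type*} [NormedAddCommGroup X] [NormedSpace ℝ X]
    (f : X → ℝ) (x : X) (xs : X →L[ℝ] ℝ) : Prop :=
  ∀ y, xs y - xs x ≤ f y - f x

/-- `x` is an `xs`-small diameter point for `f : X → ℝ`: every sequence `{xₙ}`
with `xs xₙ - f xₙ → xs x - f x` is norm convergent. -/
def SmallDiamPt {X : Type*} [NormedAddCommGroup X] [NormedSpace ℝ X]
    (f : X → ℝ) (x : X) (xs : X →L[ℝ] ℝ) : Prop :=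
  ∀ u : ℕ → X,
    Tendsto (fun n => xs (u n) - f (u n)) atTop (nhds (xs x - f x)) →
    ∃ l, Tendsto u atTop (nhds l)

/-- `f` has the small diameter property (SDP). -/
def HasSDP {X : Type*} [NormedAddCommGroup X] [NormedSpace ℝ X]
    (f : X → ℝ) : Prop :=
  ∀ (x : X) (xs : X →L[ℝ] ℝ), Subdiff f x xs → SmallDiamPt f x xs

/-- The simplex `Σ_N = {t ∈ [0,1]^N : ∑ tᵢ = 1}`. -/
def Simplex (N : ℕ) : Set (Fin N → ℝ) :=
  {t | (∀ i, t i ∈ Set.Icc (0 : ℝ) 1) ∧ (∑ i, t i) = 1}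


/-- `x₀` is a Pareto Optimum point for the family `f`. -/
def IsParetoOptimum {X : Type*} [NormedAddCommGroup X] [NormedSpace ℝ X]
    {N : ℕ} (f : Fin N → X → ℝ) (x₀ : X) : Prop :=
  ¬ ∃ x : X, (∀ k, f k x ≤ f k x₀) ∧ ∃ i, f i x < f i x₀

section Existence

variable {X : Type*} [NormedAddCommGroup X] [NormedSpace ℝ X]

/-- In a reflexive space, bounded closed convex sets are weakly compact. -/
theorem Convex.isCompact_toWeakSpace_image
    (hrefl : Function.Surjective ⇑(NormedSpace.inclusionInDoubleDual ℝ X))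
    {K : Set X} (hconv : Convex ℝ K) (hcl : IsClosed K) (hb : Bornology.IsBounded K) :
    IsClosed (toWeakSpace ℝ X '' K) ∧ IsCompact (toWeakSpace ℝ X '' K) := by
  have hc : IsClosed (toWeakSpace ℝ X '' K) := by
    rw [← closure_eq_iff_isClosed, ← hconv.toWeakSpace_closure (𝕜 := ℝ), hcl.closure_eq]
  refine ⟨hc, ?_⟩
  rw [← hc.closure_eq]
  refine NormedSpace.isCompact_closure_of_isBounded ℝ X _ ?_ ?_
  · rwa [Set.preimage_image_eq _ (toWeakSpace ℝ X).injective]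
  · intro Φ _
    obtain ⟨x, hx⟩ := hrefl Φ
    exact ⟨toWeakSpace ℝ X x, hx⟩

/-- A continuous convex coercive function on a reflexive space attains its minimum. -/
theorem ConvexOn.exists_forall_le_of_reflexive
    (hrefl : Function.Surjective ⇑(NormedSpace.inclusionInDoubleDual ℝ X))
    {g : X → ℝ} (hconv : ConvexOn ℝ Set.univ g) (hcont : Continuous g)
    (hcoer : ∀ C : ℝ, Bornology.IsBounded {x : X | g x ≤ C}) :
    ∃ x, ∀ y, g x ≤ g y := by
  have hK : ∀ y : X, IsClosed (toWeakSpace ℝ X '' {x | g x ≤ g y}) ∧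
      IsCompact (toWeakSpace ℝ X '' {x | g x ≤ g y}) := fun y =>
    Convex.isCompact_toWeakSpace_image hrefl (by simpa using hconv.convex_le (g y))
      (isClosed_le hcont continuous_const) (hcoer _)
  obtain ⟨w, hw⟩ := IsCompact.nonempty_iInter_of_directed_nonempty_isCompact_isClosed
    (fun y : X => toWeakSpace ℝ X '' {x | g x ≤ g y})
    (fun a b => by
      rcases le_total (g a) (g b) with h | h
      · exact ⟨a, subset_rfl, Set.image_mono fun x (hx : g x ≤ g a) => hx.trans h⟩
      · exact ⟨b, Set.image_mono fun x (hx : g x ≤ g b) => hx.trans h, subset_rfl⟩)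
    (fun y => ⟨_, y, le_refl (g y), rfl⟩) (fun y => (hK y).2) (fun y => (hK y).1)
  refine ⟨(toWeakSpace ℝ X).symm w, fun y => ?_⟩
  obtain ⟨x, hx, rfl⟩ := Set.mem_iInter.1 hw y
  simpa using hx

end Existence

section Convexity

variable {X : Type*} [NormedAddCommGroup X] [NormedSpace ℝ X]

/-- A continuous function on an interval with vanishing endpoint values which is strictly midpoint
convex is nonpositive. -/
theorem nonpos_of_strict_midpoint {g : ℝ → ℝ} (hc : Continuous g)
    (hg : ∀ a b : ℝ, a ≠ b → g ((a + b) / 2) < (g a + g b) / 2) (h0 : g 0 = 0) (h1 : g 1 = 0)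
    {t : ℝ} (ht : t ∈ Set.Icc (0 : ℝ) 1) : g t ≤ 0 := by
  obtain ⟨m, hm, hmax⟩ := isCompact_Icc.exists_isMaxOn (Set.nonempty_Icc.2 zero_le_one)
    hc.continuousOn
  refine (hmax ht).trans ?_
  rcases eq_or_lt_of_le hm.1 with h | hm0
  · rw [← h, h0]
  rcases eq_or_lt_of_le hm.2 with h | hm1
  · rw [h, h1]
  exfalso
  set δ := min m (1 - m)
  have hδ : 0 < δ := lt_min hm0 (by linarith)
  have hδ1 : δ ≤ m := min_le_left _ _
  have hδ2 : δ ≤ 1 - m := min_le_right _ _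
  have hlt := hg (m - δ) (m + δ) (by linarith)
  have ha : g (m - δ) ≤ g m := hmax ⟨by linarith, by linarith⟩
  have hb : g (m + δ) ≤ g m := hmax ⟨by linarith, by linarith⟩
  rw [show (m - δ + (m + δ)) / 2 = m by ring] at hlt
  linarith

theorem IsUFunction.convexOn {f : X → ℝ} (hf : IsUFunction f) : ConvexOn ℝ Set.univ f := by
  refine ⟨convex_univ, fun x _ y _ a b ha hb hab => ?_⟩
  rcases eq_or_ne x y with rfl | hxy
  · rw [← add_smul, ← add_smul, hab]; simp
  have hcont : Continuous f := hf.1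
  have key := nonpos_of_strict_midpoint
    (g := fun t => f (x + t • (y - x)) - (f x + t * (f y - f x))) (by fun_prop)
    (fun c d hcd => ?_) (by simp) (by simp) (t := b) ⟨hb, by linarith⟩
  · obtain rfl : a = 1 - b := by linarith
    have e : x + b • (y - x) = (1 - b) • x + b • y := by module
    rw [e] at key
    simp only [smul_eq_mul]
    linarith
  · have hne : x + c • (y - x) ≠ x + d • (y - x) := fun h =>
      hcd (smul_left_injective ℝ (sub_ne_zero.2 hxy.symm) (add_left_cancel h))
    have h := hf.2.1 _ _ hne
    have e : (1 / 2 : ℝ) • (x + c • (y - x) + (x + d • (y - x))) =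
        x + ((c + d) / 2) • (y - x) := by module
    rw [e] at h
    linarith

theorem ConvexOn.sum_mul {ι : Type*} {f : ι → X → ℝ} (hf : ∀ i, ConvexOn ℝ Set.univ (f i))
    {t : ι → ℝ} (ht : ∀ i, 0 ≤ t i) (s : Finset ι) :
    ConvexOn ℝ Set.univ fun x => ∑ i ∈ s, t i * f i x := by
  classical
  induction s using Finset.induction_on with
  | empty => simpa using convexOn_const (0 : ℝ) convex_univ
  | insert i s hi ih =>
    simp only [Finset.sum_insert hi]
    exact ((hf i).smul (ht i)).add ih

/-- At a minimum of a sum of two convex functions, one of which is continuous, opposite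
subgradients exist. -/
theorem ConvexOn.exists_subdiff_neg {g h : X → ℝ} (hg : ConvexOn ℝ Set.univ g)
    (hh : ConvexOn ℝ Set.univ h) (hcont : Continuous h) {x : X}
    (hmin : ∀ y, h x + g x ≤ h y + g y) :
    ∃ ξ : X →L[ℝ] ℝ, Subdiff h x ξ ∧ Subdiff g x (-ξ) := by
  set m := h x + g x with hm
  have hs : Convex ℝ {p : X × ℝ | p.1 ∈ Set.univ ∧ h p.1 < p.2} := hh.convex_strict_epigraph
  have ht : Convex ℝ {p : X × ℝ | p.1 ∈ Set.univ ∧ p.2 ≤ m - g p.1} := by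
    have : ConcaveOn ℝ Set.univ fun y => m - g y := (concaveOn_const m convex_univ).sub hg
    exact this.convex_hypograph
  obtain ⟨φ, u, h1, h2⟩ := geometric_hahn_banach_open hs
    (by simpa using isOpen_lt (hcont.comp continuous_fst) continuous_snd) ht (by
      rw [Set.disjoint_left]
      rintro ⟨y, r⟩ ⟨-, hr⟩ ⟨-, hr'⟩
      have := hmin y
      simp only at hr hr'
      linarith)
  set c := φ (0, 1)
  set ℓ : X →L[ℝ] ℝ := φ.comp (ContinuousLinearMap.inl ℝ X ℝ)
  have hφ : ∀ y r, φ (y, r) = ℓ y + r * c := by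
    intro y r
    have : ((y, r) : X × ℝ) = (y, 0) + r • (0, 1) := by simp
    rw [this, map_add, map_smul]
    rfl
  have h1' : ∀ y r, h y < r → ℓ y + r * c < u := fun y r hr => by
    rw [← hφ]; exact h1 _ ⟨trivial, hr⟩
  have h2' : ∀ y, u ≤ ℓ y + (m - g y) * c := fun y => by
    rw [← hφ]; exact h2 _ ⟨trivial, le_rfl⟩
  have hx2 := h2' x
  rw [show m - g x = h x by rw [hm]; ring] at hx2
  have hc : c < 0 := by
    have := h1' x (h x + 1) (by linarith)
    linarith
  have h3 : ∀ y, ℓ y + h y * c ≤ u := by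
    intro y
    have hlim : Tendsto (fun r : ℝ => ℓ y + r * c) (nhdsWithin (h y) (Set.Ioi (h y)))
        (nhds (ℓ y + h y * c)) :=
      ((by fun_prop : Continuous fun r : ℝ => ℓ y + r * c).tendsto _).mono_left
        nhdsWithin_le_nhds
    exact le_of_tendsto hlim (eventually_mem_nhdsWithin.mono fun r hr => (h1' y r hr).le)
  have hx3 := h3 x
  have hcc : (-c)⁻¹ * c = -1 := by rw [inv_neg, neg_mul, inv_mul_cancel₀ hc.ne]
  have hci : 0 < (-c)⁻¹ := inv_pos.2 (by linarith)
  refine ⟨(-c)⁻¹ • ℓ, fun y => ?_, fun y => ?_⟩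
  · have := mul_le_mul_of_nonneg_left (show ℓ y - ℓ x ≤ (h y - h x) * (-c) by linarith [h3 y])
      hci.le
    simp only [smul_apply, smul_eq_mul]
    linear_combination this + (h x - h y) * hcc
  · have := mul_le_mul_of_nonneg_left (show ℓ x - ℓ y ≤ (g y - g x) * (-c) by
      have := h2' y
      linear_combination this + hx3 + c * hm) hci.le
    simp only [neg_apply, smul_apply, smul_eq_mul]
    linear_combination this + (g x - g y) * hcc

end Convexity

section Scalarization

variable {X : Type*} [NormedAddCommGroup X] [NormedSpace ℝ X] {N : ℕ} {f : Fin N → X → ℝ}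
  {t : Fin N → ℝ}

theorem exists_le_of_sum_mul_le {ι : Type*} [Fintype ι] {t a : ι → ℝ} (ht : t ∈ stdSimplex ℝ ι)
    {C : ℝ} (h : ∑ i, t i * a i ≤ C) : ∃ i, a i ≤ C := by
  by_contra! hlt
  obtain ⟨i, -, hi⟩ : ∃ i ∈ Finset.univ, 0 < t i := Finset.exists_lt_of_sum_lt (by simp [ht.2])
  have : ∑ i, t i * C < ∑ i, t i * a i := Finset.sum_lt_sum
    (fun j _ => mul_le_mul_of_nonneg_left (hlt j).le (ht.1 j))
    ⟨i, Finset.mem_univ _, mul_lt_mul_of_pos_left (hlt i) hi⟩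
  rw [← Finset.sum_mul, ht.2, one_mul] at this
  linarith

theorem isBounded_iUnion_sublevel (hf : ∀ i, IsUFunction (f i)) (C : ℝ) :
    Bornology.IsBounded (⋃ i, {x | f i x ≤ C}) :=
  Bornology.isBounded_iUnion.2 fun i => (hf i).2.2.2 C

theorem exists_forall_sum_mul_le
    (hrefl : Function.Surjective ⇑(NormedSpace.inclusionInDoubleDual ℝ X))
    (hf : ∀ i, IsUFunction (f i)) (ht : t ∈ stdSimplex ℝ (Fin N)) :
    ∃ x, ∀ y, ∑ i, t i * f i x ≤ ∑ i, t i * f i y := by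
  have hcont : ∀ i, Continuous (f i) := fun i => (hf i).1
  refine ConvexOn.exists_forall_le_of_reflexive hrefl
    (ConvexOn.sum_mul (fun i => (hf i).convexOn) ht.1 _) (by fun_prop) fun C => ?_
  refine (isBounded_iUnion_sublevel hf C).subset fun x hx => ?_
  exact Set.mem_iUnion.2 (exists_le_of_sum_mul_le ht hx)

theorem eq_of_sum_mul_le (hf : ∀ i, IsUFunction (f i)) (ht : t ∈ stdSimplex ℝ (Fin N))
    {x y : X} (hx : ∀ z, ∑ i, t i * f i x ≤ ∑ i, t i * f i z)
    (hy : ∑ i, t i * f i y ≤ ∑ i, t i * f i x) : y = x := by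
  by_contra hne
  obtain ⟨i, hi⟩ := exists_le_of_sum_mul_le (a := fun i => (f i y + f i x) / 2 -
      f i ((1 / 2 : ℝ) • (y + x))) (C := 0) ht (by
    have := hx ((1 / 2 : ℝ) • (y + x))
    have e : ∑ i, t i * ((f i y + f i x) / 2 - f i ((1 / 2 : ℝ) • (y + x))) =
        (∑ i, t i * f i y + ∑ i, t i * f i x) / 2 - ∑ i, t i * f i ((1 / 2 : ℝ) • (y + x)) := by
      rw [← Finset.sum_add_distrib, Finset.sum_div, ← Finset.sum_sub_distrib]
      exact Finset.sum_congr rfl fun i _ => by ring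
    rw [e]
    linarith)
  have := (hf i).2.1 y x hne
  linarith

theorem isParetoOptimum_of_forall_sum_mul_le (hf : ∀ i, IsUFunction (f i))
    (ht : t ∈ stdSimplex ℝ (Fin N)) {x : X}
    (hx : ∀ z, ∑ i, t i * f i x ≤ ∑ i, t i * f i z) : IsParetoOptimum f x := by
  rintro ⟨y, hle, i, hi⟩
  have := eq_of_sum_mul_le hf ht hx
    (Finset.sum_le_sum fun j _ => mul_le_mul_of_nonneg_left (hle j) (ht.1 j))
  rw [this] at hi
  exact lt_irrefl _ hi

theorem IsParetoOptimum.exists_forall_sum_mul_le (hN : 0 < N) (hf : ∀ i, IsUFunction (f i))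
    {x : X} (hx : IsParetoOptimum f x) :
    ∃ t ∈ stdSimplex ℝ (Fin N), ∀ z, ∑ i, t i * f i x ≤ ∑ i, t i * f i z := by
  set S : Set (Fin N → ℝ) := {z | ∃ y, ∀ i, f i y - f i x < z i} with hS
  have hSo : IsOpen S := by
    have : S = ⋃ y, ⋂ i, {z | f i y - f i x < z i} := by ext; simp [hS]
    rw [this]
    exact isOpen_iUnion fun y => isOpen_iInter_of_finite fun i =>
      isOpen_lt continuous_const (continuous_apply i)
  have hSc : Convex ℝ S := by
    rintro z ⟨y, hy⟩ z' ⟨y', hy'⟩ a b ha hb hab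
    refine ⟨a • y + b • y', fun i => ?_⟩
    have h := (hf i).convexOn.2 (Set.mem_univ y) (Set.mem_univ y') ha hb hab
    have hlt : a * (f i y - f i x) + b * (f i y' - f i x) < a * z i + b * z' i := by
      rcases ha.eq_or_lt with rfl | ha
      · obtain rfl : b = 1 := by linarith
        simpa using hy' i
      · have h1 := mul_lt_mul_of_pos_left (hy i) ha
        have h2 := mul_le_mul_of_nonneg_left (hy' i).le hb
        linarith
    simp only [smul_eq_mul, Pi.add_apply, Pi.smul_apply] at h ⊢
    linear_combination h + hlt + f i x * hab
  have h0 : (0 : Fin N → ℝ) ∉ S := by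
    rintro ⟨y, hy⟩
    simp only [Pi.zero_apply, sub_neg] at hy
    exact hx ⟨y, fun k => (hy k).le, ⟨0, hN⟩, hy _⟩
  obtain ⟨φ, hφ⟩ := geometric_hahn_banach_point_open hSc hSo h0
  rw [map_zero] at hφ
  set τ : Fin N → ℝ := fun i => φ (Pi.single i 1)
  have hrep : ∀ z, φ z = ∑ i, τ i * z i := by
    intro z
    conv_lhs => rw [pi_eq_sum_univ' z, map_sum]
    refine Finset.sum_congr rfl fun i _ => ?_
    rw [map_smul, smul_eq_mul, mul_comm]
  have hpos : 0 < ∑ i, τ i := by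
    have := hφ (fun _ => 1) ⟨x, fun i => by simp⟩
    simpa [hrep] using this
  have hnonneg : ∀ i, 0 ≤ τ i := by
    intro i
    by_contra! hneg
    have := hφ ((fun _ => 1) + ((∑ i, τ i) / (-τ i)) • Pi.single i 1) ⟨x, fun j => by
      have : 0 ≤ (∑ i, τ i) / (-τ i) := div_nonneg hpos.le (by linarith)
      have h2 : (0 : ℝ) ≤ (Pi.single i 1 : Fin N → ℝ) j := by
        rcases eq_or_ne j i with rfl | h <;> simp [*]
      have := mul_nonneg this h2
      simp only [Pi.add_apply, Pi.smul_apply, smul_eq_mul]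
      linarith⟩
    rw [map_add, map_smul, hrep (fun _ => 1)] at this
    change 0 < ∑ i, τ i * 1 + (∑ i, τ i) / (-τ i) * τ i at this
    have e : (∑ i, τ i) / (-τ i) * τ i = -∑ i, τ i := by
      have := hneg.ne
      field_simp
    simp [e] at this
  have hmin : ∀ z, ∑ i, τ i * f i x ≤ ∑ i, τ i * f i z := by
    intro z
    refine le_of_forall_pos_lt_add fun ε hε => ?_
    have := hφ (fun i => f i z - f i x + ε / ∑ i, τ i) ⟨z, fun i => by
      have := div_pos hε hpos
      linarith⟩
    rw [hrep] at this
    simp only [mul_add, mul_sub, Finset.sum_add_distrib, Finset.sum_sub_distrib,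
      ← Finset.sum_mul] at this
    rw [mul_div_cancel₀ _ hpos.ne'] at this
    linarith
  refine ⟨fun i => (∑ i, τ i)⁻¹ * τ i, ⟨fun i => mul_nonneg (inv_nonneg.2 hpos.le) (hnonneg i), ?_⟩,
    fun z => ?_⟩
  · rw [← Finset.mul_sum, inv_mul_cancel₀ hpos.ne']
  · simp only [mul_assoc, ← Finset.mul_sum]
    exact mul_le_mul_of_nonneg_left (hmin z) (inv_nonneg.2 hpos.le)

/-- Minimizing sequences of a weighted sum of functions with the small diameter property converge
to the minimizer. -/
theorem tendsto_of_tendsto_sum_mul (hf : ∀ i, IsUFunction (f i)) (hSDP : ∀ i, HasSDP (f i))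
    (ht : t ∈ stdSimplex ℝ (Fin N)) {x : X}
    (hx : ∀ z, ∑ i, t i * f i x ≤ ∑ i, t i * f i z) {u : ℕ → X}
    (hu : Tendsto (fun n => ∑ i, t i * f i (u n)) atTop (nhds (∑ i, t i * f i x))) :
    Tendsto u atTop (nhds x) := by
  have hcont : ∀ i, Continuous (f i) := fun i => (hf i).1
  obtain ⟨i, -, hi⟩ : ∃ i ∈ Finset.univ, 0 < t i := Finset.exists_lt_of_sum_lt (by simp [ht.2])
  have hsplit : ∀ y, ∑ j, t j * f j y = t i * f i y + ∑ j ∈ Finset.univ.erase i, t j * f j y :=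
    fun y => (Finset.add_sum_erase _ _ (Finset.mem_univ i)).symm
  obtain ⟨ξ, h1, h2⟩ := ConvexOn.exists_subdiff_neg
    (h := fun y => t i * f i y) (g := fun y => ∑ j ∈ Finset.univ.erase i, t j * f j y) (x := x)
    (ConvexOn.sum_mul (fun i => (hf i).convexOn) ht.1 _) ((hf i).convexOn.smul hi.le)
    (by fun_prop) (fun y => by simpa only [← hsplit] using hx y)
  have hlim : Tendsto (fun n => ξ (u n) - t i * f i (u n)) atTop (nhds (ξ x - t i * f i x)) := by
    refine tendsto_of_tendsto_of_tendsto_of_le_of_le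
      (g := fun n => ξ x - t i * f i x - (∑ j, t j * f j (u n) - ∑ j, t j * f j x))
      (h := fun _ => ξ x - t i * f i x) ?_ tendsto_const_nhds (fun n => ?_) (fun n => ?_)
    · simpa using (hu.sub_const (∑ j, t j * f j x)).const_sub (ξ x - t i * f i x)
    · have := h2 (u n)
      simp only [neg_apply] at this
      simp only [hsplit]
      linarith
    · have := h1 (u n)
      simp only at this ⊢
      linarith
  have hti : (t i)⁻¹ * t i = 1 := inv_mul_cancel₀ hi.ne'
  obtain ⟨l, hl⟩ := hSDP i x ((t i)⁻¹ • ξ) (fun y => by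
    have := mul_le_mul_of_nonneg_left (h1 y) (inv_nonneg.2 hi.le)
    simp only [smul_apply, smul_eq_mul]
    linear_combination this + (f i y - f i x) * hti) u (by
    have := hlim.const_mul (t i)⁻¹
    simpa only [mul_sub, ← mul_assoc, hti, one_mul, smul_apply,
      smul_eq_mul] using this)
  have hl' : Tendsto (fun n => ∑ i, t i * f i (u n)) atTop (nhds (∑ i, t i * f i l)) :=
    ((by fun_prop : Continuous fun y => ∑ i, t i * f i y).tendsto l).comp hl
  rwa [eq_of_sum_mul_le hf ht hx (tendsto_nhds_unique hl' hu).le] at hl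

/-- The minimizer of a weighted sum depends continuously on the weights. -/
theorem continuous_of_forall_sum_mul_le (hf : ∀ i, IsUFunction (f i)) (hSDP : ∀ i, HasSDP (f i))
    {φ : stdSimplex ℝ (Fin N) → X}
    (hφ : ∀ t z, ∑ i, t.1 i * f i (φ t) ≤ ∑ i, t.1 i * f i z) : Continuous φ := by
  refine continuous_iff_seqContinuous.2 fun s t hst => ?_
  have hst' : ∀ i, Tendsto (fun n => (s n).1 i) atTop (nhds (t.1 i)) := fun i =>
    tendsto_pi_nhds.1 ((continuous_subtype_val.tendsto t).comp hst) i
  set x := φ t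
  set M := ∑ i, |f i x|
  have hle : ∀ i, f i x ≤ M := fun i => (le_abs_self _).trans
    (Finset.single_le_sum (f := fun i => |f i x|) (fun j _ => abs_nonneg _) (Finset.mem_univ i))
  have hmem : ∀ n, φ (s n) ∈ ⋃ i, {x | f i x ≤ M} := fun n =>
    Set.mem_iUnion.2 <| exists_le_of_sum_mul_le (s n).2 <| (hφ (s n) x).trans <| by
      calc ∑ i, (s n).1 i * f i x ≤ ∑ i, (s n).1 i * M :=
            Finset.sum_le_sum fun i _ => mul_le_mul_of_nonneg_left (hle i) ((s n).2.1 i)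
        _ = M := by rw [← Finset.sum_mul, (s n).2.2, one_mul]
  have hbdd : ∀ i, ∃ B, ∀ n, ‖f i (φ (s n))‖ ≤ B := fun i => by
    obtain ⟨B, hB⟩ := isBounded_iff_forall_norm_le.1
      ((hf i).2.2.1 _ (isBounded_iUnion_sublevel hf M))
    exact ⟨B, fun n => hB _ ⟨_, hmem n, rfl⟩⟩
  refine tendsto_of_tendsto_sum_mul hf hSDP t.2 (hφ t) ?_
  refine tendsto_of_tendsto_of_tendsto_of_le_of_le (g := fun _ => ∑ i, t.1 i * f i x)
    (h := fun n => ∑ i, (s n).1 i * f i x + ∑ i, (t.1 i - (s n).1 i) * f i (φ (s n)))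
    tendsto_const_nhds ?_ (fun n => hφ t _) (fun n => ?_)
  · rw [← add_zero (∑ i, t.1 i * f i x)]
    refine (tendsto_finsetSum _ fun i _ => (hst' i).mul_const _).add ?_
    rw [← Finset.sum_const_zero (s := (Finset.univ : Finset (Fin N)))]
    refine tendsto_finsetSum _ fun i _ => ?_
    obtain ⟨B, hB⟩ := hbdd i
    refine Tendsto.zero_mul_isBoundedUnder_le ?_ (isBoundedUnder_of ⟨B, hB⟩)
    simpa using (hst' i).const_sub (t.1 i)
  · have := hφ (s n) x
    simp only [sub_mul, Finset.sum_sub_distrib, Function.comp_apply]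
    linarith

end Scalarization

/-- Let `X` be a reflexive Banach space and `f₁, …, f_N`
U-functions, each with the small diameter property. Then the set of Pareto Optimum
points for `f₁, …, f_N` is a compact and connected subset of `X`. -/
theorem paretoSet_compact_connected
    {X : Type*} [NormedAddCommGroup X] [NormedSpace ℝ X] [CompleteSpace X]
    (hrefl : Function.Surjective ⇑(NormedSpace.inclusionInDoubleDual ℝ X))
    {N : ℕ} (hN : 0 < N) (f : Fin N → X → ℝ) (hf : ∀ i, IsUFunction (f i))
    (hSDP : ∀ i, HasSDP (f i)) :
    IsCompact {x₀ : X | IsParetoOptimum f x₀} ∧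
      IsConnected {x₀ : X | IsParetoOptimum f x₀} := by
  have : Nonempty (Fin N) := ⟨⟨0, hN⟩⟩
  choose φ hφ using fun t : stdSimplex ℝ (Fin N) => exists_forall_sum_mul_le hrefl hf t.2
  have hcont : Continuous φ := continuous_of_forall_sum_mul_le hf hSDP hφ
  have hrange : {x₀ : X | IsParetoOptimum f x₀} = Set.range φ := by
    ext x
    constructor
    · intro hx
      obtain ⟨t, ht, hmin⟩ := IsParetoOptimum.exists_forall_sum_mul_le hN hf hx
      exact ⟨⟨t, ht⟩, eq_of_sum_mul_le hf ht hmin (hφ ⟨t, ht⟩ x)⟩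
    · rintro ⟨t, rfl⟩
      exact isParetoOptimum_of_forall_sum_mul_le hf t.2 (hφ t)
  rw [hrange]
  exact ⟨isCompact_range hcont, isConnected_range hcont⟩
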